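/- arXiv:2503.07569 — 5 statements merged into one kernel-verified Lean document; each statement's English description precedes it below -/
import Mathlib

section
/- Let μ be a Borel measure on ℝⁿ which is nonzero and finite on all balls and doubling with constant D ≥ 1, let K₀, k₀ > 0 and r > 0, and let K : ℝⁿ×ℝⁿ → ℂ be measurable with |K(x,y)| ≤ K₀ · (μ(B(x,r))·μ(B(y,r)))^{−1/2} · exp(−k₀·|x−y|²/r²) for almost every (x,y) ∈ ℝⁿ×ℝⁿ (with respect to μ⊗μ). Then there is a constant C = C(K₀,k₀,D) < ∞, independent of r, such that ∫_{ℝⁿ} |K(x,y)| dμ(y) ≤ C for almost every x ∈ ℝⁿ. -/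
open MeasureTheory Metric Set ENNReal

theorem measure_ball_two_pow_mul_le {X : Type*} [PseudoMetricSpace X] [MeasurableSpace X]
    {μ : Measure X} {c : ℝ≥0∞}
    (hdbl : ∀ (x : X) (r : ℝ), 0 < r → μ (ball x (2 * r)) ≤ c * μ (ball x r))
    (x : X) {r : ℝ} (hr : 0 < r) (j : ℕ) :
    μ (ball x (2 ^ j * r)) ≤ c ^ j * μ (ball x r) := by
  induction j with
  | zero => simp
  | succ j ih =>
    calc μ (ball x (2 ^ (j + 1) * r)) = μ (ball x (2 * (2 ^ j * r))) := by
          rw [pow_succ', mul_assoc]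
      _ ≤ c * μ (ball x (2 ^ j * r)) := hdbl x _ (by positivity)
      _ ≤ c * (c ^ j * μ (ball x r)) := by gcongr
      _ = c ^ (j + 1) * μ (ball x r) := by rw [pow_succ', mul_assoc]

theorem measure_ball_le_of_mem_ball_two_pow_mul {X : Type*} [PseudoMetricSpace X]
    [MeasurableSpace X] {μ : Measure X} {c : ℝ≥0∞}
    (hdbl : ∀ (x : X) (r : ℝ), 0 < r → μ (ball x (2 * r)) ≤ c * μ (ball x r))
    {x y : X} {r : ℝ} (hr : 0 < r) {j : ℕ} (hy : y ∈ ball x (2 ^ j * r)) :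
    μ (ball x r) ≤ c ^ (j + 1) * μ (ball y r) := by
  refine le_trans (measure_mono (ball_subset_ball' ?_))
    (measure_ball_two_pow_mul_le hdbl y hr (j + 1))
  rw [mem_ball, dist_comm] at hy
  have h1 : (1 : ℝ) ≤ 2 ^ j := one_le_pow₀ one_le_two
  rw [pow_succ]
  nlinarith

theorem summable_pow_mul_exp_neg_mul_four_pow (b : ℝ) {a : ℝ} (ha : 0 < a) :
    Summable fun j : ℕ => b ^ j * Real.exp (-(a * 4 ^ j)) := by
  obtain ⟨N, hN⟩ := pow_unbounded_of_one_lt |b| (by norm_num : (1 : ℝ) < 4)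
  have hgeom : Summable fun j : ℕ => (N.factorial / a ^ N : ℝ) * (|b| / 4 ^ N) ^ j :=
    (summable_geometric_of_lt_one (by positivity) ((div_lt_one (by positivity)).2 hN)).mul_left _
  refine Summable.of_norm_bounded hgeom fun j => ?_
  have hpos : (0 : ℝ) < a * 4 ^ j := by positivity
  have h := Real.pow_div_factorial_le_exp (a * 4 ^ j) hpos.le N
  rw [norm_mul, norm_pow, Real.norm_eq_abs, Real.norm_eq_abs, Real.abs_exp, Real.exp_neg]
  calc |b| ^ j * (Real.exp (a * 4 ^ j))⁻¹
      ≤ |b| ^ j * ((a * 4 ^ j) ^ N / N.factorial)⁻¹ := by gcongr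
    _ = (N.factorial / a ^ N : ℝ) * (|b| / 4 ^ N) ^ j := by
      rw [mul_pow, ← pow_mul, mul_comm j N, pow_mul, div_pow]
      field_simp

theorem exists_lt_two_pow_mul_and_four_pow_le (d : ℝ) {r : ℝ} (hr : 0 < r) :
    ∃ j : ℕ, d < 2 ^ j * r ∧ (4 : ℝ) ^ j / 4 - 1 ≤ d ^ 2 / r ^ 2 := by
  have hex : ∃ j : ℕ, d / r < 2 ^ j := pow_unbounded_of_one_lt _ one_lt_two
  classical
  refine ⟨Nat.find hex, (div_lt_iff₀ hr).1 (Nat.find_spec hex), ?_⟩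
  rw [← div_pow]
  rcases h : Nat.find hex with _ | k
  · have := sq_nonneg (d / r)
    norm_num
    linarith
  · have hk : (2 : ℝ) ^ k ≤ d / r := not_lt.1 (Nat.find_min hex (h ▸ Nat.lt_succ_self k))
    have h4 : (4 : ℝ) ^ k = (2 ^ k) ^ 2 := by rw [← pow_mul, mul_comm, pow_mul]; norm_num
    have : ((2 : ℝ) ^ k) ^ 2 ≤ (d / r) ^ 2 := by gcongr
    rw [pow_succ, h4]
    linarith

theorem div_sqrt_mul_sqrt_le {K₀ v w q : ℝ} (hK₀ : 0 ≤ K₀) (hv : 0 < v) (hq : 1 ≤ q)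
    (hvw : v ≤ q * w) : K₀ / (√v * √w) ≤ K₀ * q / v := by
  have hq0 : 0 < q := one_pos.trans_le hq
  have hw : 0 < w := pos_of_mul_pos_right (hv.trans_le hvw) hq0.le
  have hsqrt : √v ≤ q * √w := by
    refine (Real.sqrt_le_sqrt (hvw.trans (?_ : q * w ≤ q ^ 2 * w))).trans_eq ?_
    · gcongr
      nlinarith
    · rw [Real.sqrt_mul (by positivity), Real.sqrt_sq hq0.le]
  rw [div_le_div_iff₀ (by positivity) hv, mul_assoc]
  gcongr
  calc v = √v * √v := (Real.mul_self_sqrt hv.le).symm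
    _ ≤ √v * (q * √w) := by gcongr
    _ = q * (√v * √w) := by ring

/-- A Gaussian-type bound on a doubling space has integral at most the sum of its bounds over the
dyadic balls. -/
theorem lintegral_gaussian_bound_le {X : Type*} [PseudoMetricSpace X] [MeasurableSpace X]
    [OpensMeasurableSpace X] {μ : Measure X} {D K₀ k₀ r : ℝ} (hD : 1 ≤ D) (hK₀ : 0 ≤ K₀)
    (hk₀ : 0 < k₀) (hr : 0 < r)
    (hball : ∀ (x : X) (r : ℝ), 0 < r → μ (ball x r) ≠ 0 ∧ μ (ball x r) ≠ ⊤)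
    (hdbl : ∀ (x : X) (r : ℝ), 0 < r →
      μ (ball x (2 * r)) ≤ ENNReal.ofReal D * μ (ball x r)) (x : X) :
    ∫⁻ y, ENNReal.ofReal (K₀ / (√(μ (ball x r)).toReal * √(μ (ball y r)).toReal) *
        Real.exp (-(k₀ * dist x y ^ 2 / r ^ 2))) ∂μ ≤
      ENNReal.ofReal (∑' j : ℕ,
        K₀ * D * Real.exp k₀ * ((D ^ 2) ^ j * Real.exp (-(k₀ / 4 * 4 ^ j)))) := by
  have hD0 : 0 < D := one_pos.trans_le hD
  set v := (μ (ball x r)).toReal 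
  have hv : 0 < v := ENNReal.toReal_pos (hball x r hr).1 (hball x r hr).2
  set c : ℕ → ℝ := fun j =>
    K₀ * D ^ (j + 1) / v * (Real.exp k₀ * Real.exp (-(k₀ / 4 * 4 ^ j))) with hc
  have hpt : ∀ y, ENNReal.ofReal (K₀ / (√v * √(μ (ball y r)).toReal) *
        Real.exp (-(k₀ * dist x y ^ 2 / r ^ 2))) ≤
      ∑' j : ℕ, (ball x (2 ^ j * r)).indicator (fun _ => ENNReal.ofReal (c j)) y := by
    intro y
    obtain ⟨j, hj, hexp⟩ := exists_lt_two_pow_mul_and_four_pow_le (dist x y) hr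
    have hy : y ∈ ball x (2 ^ j * r) := by rwa [mem_ball, dist_comm]
    refine le_trans ?_ (ENNReal.le_tsum j)
    rw [indicator_of_mem hy]
    refine ENNReal.ofReal_le_ofReal (mul_le_mul ?_ ?_ (Real.exp_nonneg _) (by positivity))
    · refine div_sqrt_mul_sqrt_le hK₀ hv (one_le_pow₀ hD) ?_
      have h := measure_ball_le_of_mem_ball_two_pow_mul hdbl hr hy
      have h' := ENNReal.toReal_mono (ENNReal.mul_ne_top (by finiteness) (hball y r hr).2) h
      rwa [ENNReal.toReal_mul, ENNReal.toReal_pow, ENNReal.toReal_ofReal hD0.le] at h'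
    · rw [← Real.exp_add, Real.exp_le_exp, mul_div_assoc]
      nlinarith
  have hterm : ∀ j, ENNReal.ofReal (c j) * μ (ball x (2 ^ j * r)) ≤
      ENNReal.ofReal
        (K₀ * D * Real.exp k₀ * ((D ^ 2) ^ j * Real.exp (-(k₀ / 4 * 4 ^ j)))) := by
    intro j
    have hcj : 0 ≤ c j := by positivity
    calc ENNReal.ofReal (c j) * μ (ball x (2 ^ j * r))
        ≤ ENNReal.ofReal (c j) * (ENNReal.ofReal D ^ j * μ (ball x r)) := by
          gcongr
          exact measure_ball_two_pow_mul_le hdbl x hr j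
      _ = ENNReal.ofReal (c j * (D ^ j * v)) := by
          rw [ENNReal.ofReal_mul hcj, ENNReal.ofReal_mul (p := D ^ j) (by positivity),
            ENNReal.ofReal_pow hD0.le, ENNReal.ofReal_toReal (hball x r hr).2]
      _ = _ := by
          congr 1
          simp only [hc]
          field_simp
          ring
  calc _ ≤ ∫⁻ y, ∑' j : ℕ,
        (ball x (2 ^ j * r)).indicator (fun _ => ENNReal.ofReal (c j)) y ∂μ := lintegral_mono hpt
    _ = ∑' j : ℕ, ENNReal.ofReal (c j) * μ (ball x (2 ^ j * r)) := by
        rw [lintegral_tsum fun j =>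
          (measurable_const.indicator measurableSet_ball).aemeasurable]
        simp_rw [lintegral_indicator_const measurableSet_ball]
    _ ≤ ∑' j : ℕ, ENNReal.ofReal
        (K₀ * D * Real.exp k₀ * ((D ^ 2) ^ j * Real.exp (-(k₀ / 4 * 4 ^ j)))) :=
        ENNReal.tsum_le_tsum hterm
    _ = _ := (ENNReal.ofReal_tsum_of_nonneg (fun j => by positivity)
        ((summable_pow_mul_exp_neg_mul_four_pow _ (by positivity)).mul_left _)).symm

/-- For `D ≥ 1` and `K₀, k₀ > 0` there is a constant `C = C(K₀,k₀,D) < ∞`,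
independent of `r`, such that for every Borel measure `μ` on `ℝⁿ` nonzero and finite on balls
and doubling with constant `D`, every `r > 0` and every measurable kernel `K` satisfying
`|K(x,y)| ≤ K₀ (μ(B(x,r))μ(B(y,r)))^{-1/2} exp(−k₀|x−y|²/r²)` for `μ⊗μ`-a.e. `(x,y)`,
one has `∫ |K(x,y)| dμ(y) ≤ C` for `μ`-a.e. `x`. -/
theorem statement3 (n : ℕ) (D K₀ k₀ : ℝ) (hD : 1 ≤ D) (hK₀ : 0 < K₀) (hk₀ : 0 < k₀) :
    ∃ C : ℝ, 0 < C ∧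
      ∀ μ : Measure (EuclideanSpace ℝ (Fin n)),
        (∀ (x : EuclideanSpace ℝ (Fin n)) (r : ℝ), 0 < r → μ (ball x r) ≠ 0 ∧ μ (ball x r) ≠ ⊤) →
        (∀ (x : EuclideanSpace ℝ (Fin n)) (r : ℝ), 0 < r →
          μ (ball x (2 * r)) ≤ ENNReal.ofReal D * μ (ball x r)) →
        ∀ r : ℝ, 0 < r →
        ∀ K : EuclideanSpace ℝ (Fin n) → EuclideanSpace ℝ (Fin n) → ℂ,
          Measurable (Function.uncurry K) →
          (∀ᵐ p ∂(μ.prod μ), ‖K p.1 p.2‖ ≤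
              K₀ / (Real.sqrt (μ (ball p.1 r)).toReal * Real.sqrt (μ (ball p.2 r)).toReal) *
                Real.exp (-(k₀ * dist p.1 p.2 ^ 2 / r ^ 2))) →
          ∀ᵐ x ∂μ, ∫⁻ y, (‖K x y‖₊ : ℝ≥0∞) ∂μ ≤ ENNReal.ofReal C := by
  have hD0 : 0 < D := one_pos.trans_le hD
  refine ⟨∑' j : ℕ, K₀ * D * Real.exp k₀ * ((D ^ 2) ^ j * Real.exp (-(k₀ / 4 * 4 ^ j))),
    Summable.tsum_pos ((summable_pow_mul_exp_neg_mul_four_pow _ (by positivity)).mul_left _)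
      (fun j => by positivity) 0 (by positivity), ?_⟩
  intro μ hball hdbl r hr K _ hK
  have : IsLocallyFiniteMeasure μ :=
    ⟨fun x => ⟨ball x 1, ball_mem_nhds x one_pos, (hball x 1 one_pos).2.lt_top⟩⟩
  filter_upwards [Measure.ae_ae_of_ae_prod hK] with x hx
  refine (lintegral_mono_ae ?_).trans
    (lintegral_gaussian_bound_le hD hK₀.le hk₀ hr hball hdbl x)
  filter_upwards [hx] with y hy
  rw [← enorm_eq_nnnorm, ← ofReal_norm]
  exact ENNReal.ofReal_le_ofReal hy
end

section
/- Let ω : ℝⁿ → (0,∞) be locally integrable such that the measure dω := ω(x)dx is doubling with constant D ≥ 1, and let k₀ > 0. There is a constant C = C(k₀,D) > 0 such that for every x₀ ∈ ℝⁿ, every t₀ ∈ ℝ, every R > 0 and every z ∈ B(x₀,R): ∬_{Σ'} ω(B(z,√(t₀−s)))^{−2} · exp(−k₀·|z−y|²/(t₀−s)) · ω(y) dy ds ≤ C · R² / ω(B(x₀,2R)), where Σ' := Q_{4R}(t₀,x₀) ∖ Q_{√(9/8)·R}(t₀,x₀). -/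
open MeasureTheory Metric Set ENNReal

noncomputable section

/-- The weighted measure `dω = ω(x)dx` on `ℝⁿ`. -/
def wMeasure (n : ℕ) (ω : EuclideanSpace ℝ (Fin n) → ℝ) :
    Measure (EuclideanSpace ℝ (Fin n)) :=
  volume.withDensity fun x => ENNReal.ofReal (ω x)

/-- The measure `dμ(t,x) = ω(x)dx dt` on `ℝ × ℝⁿ`. -/
def pMeasure (n : ℕ) (ω : EuclideanSpace ℝ (Fin n) → ℝ) :
    Measure (ℝ × EuclideanSpace ℝ (Fin n)) :=
  (volume : Measure ℝ).prod (wMeasure n ω)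

/-- The parabolic cylinder `Q_r(t,x) = (t−r², t] × B(x,r)`. -/
def Qcyl (n : ℕ) (r t : ℝ) (x : EuclideanSpace ℝ (Fin n)) :
    Set (ℝ × EuclideanSpace ℝ (Fin n)) :=
  Set.Ioc (t - r ^ 2) t ×ˢ Metric.ball x r

/-- A geometric sequence is dominated by a double exponential, uniformly. -/
lemma pow_mul_exp_neg_four_pow_le {D κ : ℝ} (hD : 1 ≤ D) (hκ : 0 < κ) (k : ℕ) :
    (D ^ k) ^ 2 * Real.exp (-(κ * 4 ^ k)) ≤ Real.exp (Real.log D ^ 2 / κ) := by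
  have hpow : (D ^ k) ^ 2 = Real.exp (2 * k * Real.log D) := by
    rw [← pow_mul, ← Real.exp_log (pow_pos (zero_lt_one.trans_le hD) (k * 2)), Real.log_pow]
    push_cast
    ring_nf
  rw [hpow, ← Real.exp_add, Real.exp_le_exp, le_div_iff₀ hκ]
  have hk : (k : ℝ) ≤ 2 ^ k := by exact_mod_cast Nat.lt_two_pow_self.le
  have h4 : (4 : ℝ) ^ k = (2 ^ k) ^ 2 := by rw [← pow_mul, mul_comm, pow_mul]; norm_num
  have hlog : 0 ≤ Real.log D := Real.log_nonneg hD
  have hle : k * Real.log D * κ ≤ 2 ^ k * Real.log D * κ := by gcongr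
  rw [h4]
  nlinarith [sq_nonneg (Real.log D - κ * 2 ^ k)]

/-- The least dyadic multiple of `a < b` that reaches `b` stays below `2 * b`. -/
lemma exists_two_pow_mul_mem_Ico {a b : ℝ} (ha : 0 < a) (hab : a < b) :
    ∃ k : ℕ, b ≤ 2 ^ k * a ∧ 2 ^ k * a < 2 * b := by
  obtain ⟨k, hk, hk'⟩ := exists_nat_pow_near (x := b / a) (y := 2)
    ((one_le_div ha).2 hab.le) one_lt_two
  rw [le_div_iff₀ ha] at hk
  rw [div_lt_iff₀ ha] at hk'
  rcases hk.eq_or_lt with h | h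
  · exact ⟨k, h.ge, by linarith⟩
  · exact ⟨k + 1, hk'.le, by rw [pow_succ]; linarith⟩

section Doubling

variable {X : Type*} [PseudoMetricSpace X] [MeasurableSpace X] {ν : Measure X}

lemma measure_ball_two_pow_mul_le_s4 {D : ℝ≥0∞}
    (hν : ∀ (x : X) (r : ℝ), 0 < r → ν (ball x (2 * r)) ≤ D * ν (ball x r))
    (x : X) {r : ℝ} (hr : 0 < r) (k : ℕ) :
    ν (ball x (2 ^ k * r)) ≤ D ^ k * ν (ball x r) := by
  induction k with
  | zero => simp
  | succ k ih =>
    calc ν (ball x (2 ^ (k + 1) * r)) = ν (ball x (2 * (2 ^ k * r))) := by ring_nf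
      _ ≤ D * ν (ball x (2 ^ k * r)) := hν x _ (by positivity)
      _ ≤ D * (D ^ k * ν (ball x r)) := by gcongr
      _ = D ^ (k + 1) * ν (ball x r) := by ring

lemma inv_measure_ball_le_of_le_two_pow_mul {D : ℝ} (hD : 1 ≤ D)
    (hν : ∀ (x : X) (r : ℝ), 0 < r → ν (ball x (2 * r)) ≤ ENNReal.ofReal D * ν (ball x r))
    {x z : X} {r ρ : ℝ} (hr : 0 < r) {k : ℕ} (hk : dist x z + ρ ≤ 2 ^ k * r) :
    (ν (ball z r))⁻¹ ≤ ENNReal.ofReal (D ^ k) * (ν (ball x ρ))⁻¹ := by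
  have hD0 : 0 < D ^ k := pow_pos (zero_lt_one.trans_le hD) k
  have hle : ν (ball x ρ) ≤ ENNReal.ofReal (D ^ k) * ν (ball z r) := by
    rw [ENNReal.ofReal_pow (zero_le_one.trans hD)]
    exact (measure_mono (ball_subset_ball' (by linarith))).trans
      (measure_ball_two_pow_mul_le_s4 hν z hr k)
  have hinv := ENNReal.inv_le_inv.2 hle
  rw [ENNReal.mul_inv (.inl (by simpa using hD0)) (.inl ENNReal.ofReal_ne_top)] at hinv
  calc (ν (ball z r))⁻¹
      = ENNReal.ofReal (D ^ k) * ((ENNReal.ofReal (D ^ k))⁻¹ * (ν (ball z r))⁻¹) := by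
        rw [← mul_assoc, ENNReal.mul_inv_cancel (by simpa using hD0) ENNReal.ofReal_ne_top,
          one_mul]
    _ ≤ _ := by gcongr

/-- Off-diagonal Gaussian bound: away from the space-time point `(0, z)` the squared heat kernel
bound is controlled by the measure of a ball at the ambient scale. -/
lemma inv_measure_ball_sq_mul_exp_le {D k₀ c : ℝ} (hD : 1 ≤ D) (hk₀ : 0 < k₀) (hc : 0 < c)
    (hν : ∀ (x : X) (r : ℝ), 0 < r → ν (ball x (2 * r)) ≤ ENNReal.ofReal D * ν (ball x r))
    {x z y : X} {τ R : ℝ} (hR : 0 < R) (hxz : dist x z ≤ R) (hτ : 0 < τ)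
    (hτR : τ < (4 * R) ^ 2) (hfar : R ^ 2 ≤ τ ∨ c * R ≤ dist z y) :
    ((ν (ball z (Real.sqrt τ)))⁻¹) ^ 2 *
        ENNReal.ofReal (Real.exp (-(k₀ * dist z y ^ 2 / τ))) ≤
      ENNReal.ofReal (D ^ 6 + Real.exp (Real.log D ^ 2 / (k₀ * c ^ 2 / 256))) *
        ((ν (ball x (4 * R)))⁻¹) ^ 2 := by
  have hs : 0 < Real.sqrt τ := Real.sqrt_pos.2 hτ
  have hsq : Real.sqrt τ ^ 2 = τ := Real.sq_sqrt hτ.le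
  obtain ⟨k, hk, hexp⟩ : ∃ k : ℕ, 8 * R ≤ 2 ^ k * Real.sqrt τ ∧
      (D ^ k) ^ 2 * Real.exp (-(k₀ * dist z y ^ 2 / τ)) ≤
        D ^ 6 + Real.exp (Real.log D ^ 2 / (k₀ * c ^ 2 / 256)) := by
    rcases hfar with h | h
    · refine ⟨3, by linarith [Real.le_sqrt_of_sq_le h], ?_⟩
      have : Real.exp (-(k₀ * dist z y ^ 2 / τ)) ≤ 1 :=
        Real.exp_le_one_iff.2 (neg_nonpos.2 (by positivity))
      calc (D ^ 3) ^ 2 * Real.exp (-(k₀ * dist z y ^ 2 / τ)) ≤ (D ^ 3) ^ 2 * 1 := by gcongr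
        _ = D ^ 6 := by ring
        _ ≤ _ := le_add_of_nonneg_right (Real.exp_pos _).le
    · have hlt : Real.sqrt τ < 8 * R :=
        ((Real.sqrt_lt' (by positivity)).2 hτR).trans (by linarith)
      obtain ⟨k, hk, hk'⟩ := exists_two_pow_mul_mem_Ico hs hlt
      refine ⟨k, hk, ?_⟩
      have h4 : 4 ^ k * τ ≤ 256 * R ^ 2 := by
        calc (4 : ℝ) ^ k * τ = (2 ^ k * Real.sqrt τ) ^ 2 := by
              rw [mul_pow, hsq, ← pow_mul, mul_comm k, pow_mul]; norm_num
          _ ≤ (2 * (8 * R)) ^ 2 := by gcongr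
          _ = 256 * R ^ 2 := by ring
      have hle : k₀ * c ^ 2 / 256 * 4 ^ k ≤ k₀ * dist z y ^ 2 / τ := by
        rw [le_div_iff₀ hτ]
        calc k₀ * c ^ 2 / 256 * 4 ^ k * τ = k₀ * c ^ 2 / 256 * (4 ^ k * τ) := by ring
          _ ≤ k₀ * c ^ 2 / 256 * (256 * R ^ 2) := by gcongr
          _ = k₀ * (c * R) ^ 2 := by ring
          _ ≤ k₀ * dist z y ^ 2 := by gcongr
      calc (D ^ k) ^ 2 * Real.exp (-(k₀ * dist z y ^ 2 / τ))
          ≤ (D ^ k) ^ 2 * Real.exp (-(k₀ * c ^ 2 / 256 * 4 ^ k)) := by gcongr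
        _ ≤ Real.exp (Real.log D ^ 2 / (k₀ * c ^ 2 / 256)) :=
          pow_mul_exp_neg_four_pow_le hD (by positivity) k
        _ ≤ _ := le_add_of_nonneg_left (by positivity)
  have hinv := inv_measure_ball_le_of_le_two_pow_mul hD hν (x := x) (z := z) (ρ := 4 * R) hs
    (k := k) (by linarith)
  calc ((ν (ball z (Real.sqrt τ)))⁻¹) ^ 2 *
        ENNReal.ofReal (Real.exp (-(k₀ * dist z y ^ 2 / τ)))
      ≤ (ENNReal.ofReal (D ^ k) * (ν (ball x (4 * R)))⁻¹) ^ 2 *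
        ENNReal.ofReal (Real.exp (-(k₀ * dist z y ^ 2 / τ))) := by gcongr
    _ = ENNReal.ofReal ((D ^ k) ^ 2 * Real.exp (-(k₀ * dist z y ^ 2 / τ))) *
        ((ν (ball x (4 * R)))⁻¹) ^ 2 := by
      rw [ENNReal.ofReal_mul (by positivity), ENNReal.ofReal_pow (p := D ^ k) (by positivity)]
      ring
    _ ≤ _ := by gcongr

end Doubling

/-- Let `ω : ℝⁿ → (0,∞)` be locally integrable with `dω = ω dx` doubling with
constant `D ≥ 1`, and `k₀ > 0`. There is `C = C(k₀,D) > 0` such that for every `x₀`, `t₀`,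
`R > 0` and `z ∈ B(x₀,R)`,
`∬_{Σ'} ω(B(z,√(t₀−s)))⁻² exp(−k₀|z−y|²/(t₀−s)) ω(y) dy ds ≤ C R² / ω(B(x₀,2R))`,
where `Σ' = Q_{4R}(t₀,x₀) ∖ Q_{√(9/8)R}(t₀,x₀)`. -/
theorem statement4 (n : ℕ) (D k₀ : ℝ) (hD : 1 ≤ D) (hk₀ : 0 < k₀) :
    ∃ C : ℝ, 0 < C ∧
      ∀ ω : EuclideanSpace ℝ (Fin n) → ℝ,
        Measurable ω → (∀ x, 0 < ω x) → LocallyIntegrable ω volume →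
        (∀ (x : EuclideanSpace ℝ (Fin n)) (r : ℝ), 0 < r →
          wMeasure n ω (ball x (2 * r)) ≤ ENNReal.ofReal D * wMeasure n ω (ball x r)) →
        ∀ (x₀ : EuclideanSpace ℝ (Fin n)) (t₀ R : ℝ), 0 < R →
          ∀ z ∈ ball x₀ R,
            (∫⁻ p in Qcyl n (4 * R) t₀ x₀ \ Qcyl n (Real.sqrt (9 / 8) * R) t₀ x₀,
                ((wMeasure n ω (ball z (Real.sqrt (t₀ - p.1))))⁻¹) ^ 2 *
                  ENNReal.ofReal (Real.exp (-(k₀ * dist z p.2 ^ 2 / (t₀ - p.1))))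
                ∂(pMeasure n ω))
              ≤ ENNReal.ofReal (C * R ^ 2) / wMeasure n ω (ball x₀ (2 * R)) := by
  have hc : 0 < Real.sqrt (9 / 8) - 1 := by
    rw [sub_pos, Real.lt_sqrt zero_le_one]
    norm_num
  set c : ℝ := Real.sqrt (9 / 8) - 1 with hc_def
  set M : ℝ := D ^ 6 + Real.exp (Real.log D ^ 2 / (k₀ * c ^ 2 / 256))
  have hM : 0 < M := by positivity
  refine ⟨16 * M, by positivity, fun ω _ _ _ hdoub x₀ t₀ R hR z hz => ?_⟩
  have : SFinite (wMeasure n ω) := by unfold wMeasure; infer_instance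
  set ν := wMeasure n ω
  have hmeas : ∀ r, MeasurableSet (Qcyl n r t₀ x₀) := fun r =>
    measurableSet_Ioc.prod measurableSet_ball
  have hne : ∀ᵐ p ∂(pMeasure n ω), p.1 ≠ t₀ :=
    Measure.quasiMeasurePreserving_fst.ae (Measure.ae_ne volume t₀)
  have hbound : ∀ᵐ p ∂((pMeasure n ω).restrict
      (Qcyl n (4 * R) t₀ x₀ \ Qcyl n (Real.sqrt (9 / 8) * R) t₀ x₀)),
      ((ν (ball z (Real.sqrt (t₀ - p.1))))⁻¹) ^ 2 *
          ENNReal.ofReal (Real.exp (-(k₀ * dist z p.2 ^ 2 / (t₀ - p.1)))) ≤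
        ENNReal.ofReal M * ((ν (ball x₀ (4 * R)))⁻¹) ^ 2 := by
    filter_upwards [ae_restrict_mem ((hmeas _).diff (hmeas _)), ae_restrict_of_ae hne]
      with ⟨s, y⟩ ⟨⟨⟨hs₁, hs₂⟩, _⟩, hnot⟩ hst
    simp only at hs₁ hs₂ hst
    rw [mem_ball'] at hz
    refine inv_measure_ball_sq_mul_exp_le hD hk₀ hc hdoub hR hz.le
      (sub_pos.2 (lt_of_le_of_ne hs₂ hst)) (by linarith) ?_
    by_contra! hcon
    refine hnot ⟨⟨?_, hs₂⟩, ?_⟩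
    · have : (Real.sqrt (9 / 8) * R) ^ 2 = 9 / 8 * R ^ 2 := by
        rw [mul_pow, Real.sq_sqrt (by norm_num)]
      simp only [this]
      nlinarith [hcon.1]
    · rw [mem_ball']
      have := dist_triangle x₀ z y
      nlinarith [hcon.2]
  calc _ ≤ ∫⁻ _ in Qcyl n (4 * R) t₀ x₀ \ Qcyl n (Real.sqrt (9 / 8) * R) t₀ x₀,
        ENNReal.ofReal M * ((ν (ball x₀ (4 * R)))⁻¹) ^ 2 ∂(pMeasure n ω) :=
      lintegral_mono_ae hbound
    _ ≤ ENNReal.ofReal M * ((ν (ball x₀ (4 * R)))⁻¹) ^ 2 *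
        pMeasure n ω (Qcyl n (4 * R) t₀ x₀) := by
      rw [setLIntegral_const]
      gcongr
      exact sdiff_subset
    _ = ENNReal.ofReal (16 * M * R ^ 2) *
        (ν (ball x₀ (4 * R)) * (ν (ball x₀ (4 * R)))⁻¹) * (ν (ball x₀ (4 * R)))⁻¹ := by
      rw [pMeasure, Qcyl, Measure.prod_prod, Real.volume_Ioc,
        show 16 * M * R ^ 2 = M * (t₀ - (t₀ - (4 * R) ^ 2)) by ring, ENNReal.ofReal_mul hM.le]
      ring
    _ ≤ ENNReal.ofReal (16 * M * R ^ 2) * 1 * (ν (ball x₀ (2 * R)))⁻¹ := by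
      gcongr
      · exact ENNReal.mul_inv_le_one _
      · norm_num
    _ = _ := by rw [mul_one, div_eq_mul_inv]
end
end

section
/- Let 𝔗 ∈ ℝ, let 𝒪 ⊆ ℝⁿ be open, and let u : (𝔗,∞)×𝒪 → [0,∞) satisfy the following Harnack-type property for some constant C₀ ≥ 1: for every z ∈ 𝒪 and R > 0 with B(z,2R) ⊆ 𝒪, every τ with 𝔗 < τ − (3/2)R², and every z' ∈ B(z,R), one has u(τ,z) ≤ C₀·u(τ+R², z'). Let 𝒪' ⊆ 𝒪 be a convex open set with δ := dist(𝒪', ∂𝒪) > 0. Then for all t > s > 𝔗 and all x, y ∈ 𝒪': u(s,y) ≤ u(t,x) · exp( (log C₀)·( |x−y|²/(t−s) + 4(t−s)/δ² + 3(t−s)/(2(s−𝔗)) + 1 ) ). -/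
open MeasureTheory Metric Set ENNReal

/-- An open ball centred in an open set `O` whose radius is at most the distance from its
centre to the frontier of `O` is contained in `O`. -/
theorem ball_subset_of_le_infDist_frontier {E : Type*} [SeminormedAddCommGroup E]
    [NormedSpace ℝ E] {O : Set E} (hO : IsOpen O) {z : E} {r : ℝ} (hz : z ∈ O)
    (hr : r ≤ infDist z (frontier O)) : ball z r ⊆ O := by
  rcases le_or_gt r 0 with hr0 | hr0
  · simp [ball_eq_empty.2 hr0]
  refine (convex_ball z r).isPreconnected.subset_of_closure_inter_subset hO
    ⟨z, mem_ball_self hr0, hz⟩ fun p ⟨hpO, hp⟩ ↦ ?_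
  by_contra hpn
  have hle := infDist_le_dist_of_mem (x := z) (hO.frontier_eq ▸ ⟨hpO, hpn⟩ : p ∈ frontier O)
  rw [mem_ball'] at hp
  linarith

/-- Iterating a one-step Harnack inequality with radius `R` along `k` equally spaced points of
the segment from `y` to `x`. -/
theorem le_pow_mul_of_harnack_chain {E : Type*} [NormedAddCommGroup E] [NormedSpace ℝ E]
    {S : Set E} (hS : Convex ℝ S) {u : ℝ × E → ℝ} {C R s : ℝ} (hC : 0 ≤ C)
    (hstep : ∀ z ∈ S, ∀ τ, s ≤ τ → ∀ z' ∈ ball z R, u (τ, z) ≤ C * u (τ + R ^ 2, z'))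
    {x y : E} (hx : x ∈ S) (hy : y ∈ S) {k : ℕ} (hk : 0 < k) (hxy : dist x y < k * R) :
    u (s, y) ≤ C ^ k * u (s + k * R ^ 2, x) := by
  have hk0 : (0 : ℝ) < k := by exact_mod_cast hk
  have chain : ∀ i : ℕ, i ≤ k →
      u (s, y) ≤ C ^ i * u (s + i * R ^ 2, AffineMap.lineMap y x ((i : ℝ) / k)) := by
    intro i
    induction i with
    | zero => intro _; simp
    | succ i ih =>
      intro hi
      have hik : (i : ℝ) ≤ k := by exact_mod_cast (Nat.le_succ i).trans hi
      have hz : AffineMap.lineMap y x ((i : ℝ) / k) ∈ S :=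
        hS.lineMap_mem hy hx ⟨by positivity, (div_le_one hk0).2 hik⟩
      have hz' : AffineMap.lineMap y x (((i + 1 : ℕ) : ℝ) / k) ∈
          ball (AffineMap.lineMap y x ((i : ℝ) / k)) R := by
        have hsub : ((i + 1 : ℕ) : ℝ) / k - (i : ℝ) / k = 1 / k := by push_cast; ring
        rw [mem_ball, dist_lineMap_lineMap, Real.dist_eq, hsub, abs_of_pos (by positivity),
          dist_comm y x, one_div_mul_eq_div, div_lt_iff₀' hk0]
        exact hxy
      have hτ : s ≤ s + i * R ^ 2 := le_add_of_nonneg_right (by positivity)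
      calc u (s, y) ≤ C ^ i * u (s + i * R ^ 2, AffineMap.lineMap y x ((i : ℝ) / k)) :=
            ih ((Nat.le_succ i).trans hi)
        _ ≤ C ^ i * (C * u (s + i * R ^ 2 + R ^ 2,
              AffineMap.lineMap y x (((i + 1 : ℕ) : ℝ) / k))) :=
            mul_le_mul_of_nonneg_left (hstep _ hz _ hτ _ hz') (pow_nonneg hC i)
        _ = _ := by
            rw [← mul_assoc, ← pow_succ]
            congr 3
            push_cast
            ring
  simpa [div_self hk0.ne'] using chain k le_rfl

/-- Harnack chain iteration in a convex subdomain. Let `𝔗 ∈ ℝ`, `𝒪 ⊆ ℝⁿ` open,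
`u : (𝔗,∞)×𝒪 → [0,∞)` satisfying the Harnack-type property with constant `C₀ ≥ 1`: for every
`z ∈ 𝒪`, `R > 0` with `B(z,2R) ⊆ 𝒪`, every `τ` with `𝔗 < τ − (3/2)R²` and every `z' ∈ B(z,R)`,
`u(τ,z) ≤ C₀ u(τ+R²,z')`. Let `𝒪' ⊆ 𝒪` be convex open whose distance `δ` to `∂𝒪` is positive.
Then for all `t > s > 𝔗` and `x, y ∈ 𝒪'`,
`u(s,y) ≤ u(t,x) exp((log C₀)(|x−y|²/(t−s) + 4(t−s)/δ² + 3(t−s)/(2(s−𝔗)) + 1))`. -/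
theorem statement5 (n : ℕ) (𝔗 : ℝ) (O O' : Set (EuclideanSpace ℝ (Fin n)))
    (hO : IsOpen O) (hO' : IsOpen O') (hO'O : O' ⊆ O) (hconv : Convex ℝ O')
    (δ : ℝ) (hδ : 0 < δ) (hdist : ∀ x ∈ O', δ ≤ infDist x (frontier O))
    (u : ℝ × EuclideanSpace ℝ (Fin n) → ℝ) (hu : ∀ p, 0 ≤ u p)
    (C₀ : ℝ) (hC₀ : 1 ≤ C₀)
    (hHarnack : ∀ z ∈ O, ∀ R : ℝ, 0 < R → ball z (2 * R) ⊆ O →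
      ∀ τ : ℝ, 𝔗 < τ - 3 / 2 * R ^ 2 →
      ∀ z' ∈ ball z R, u (τ, z) ≤ C₀ * u (τ + R ^ 2, z')) :
    ∀ s t : ℝ, 𝔗 < s → s < t → ∀ x ∈ O', ∀ y ∈ O',
      u (s, y) ≤ u (t, x) *
        Real.exp (Real.log C₀ *
          (dist x y ^ 2 / (t - s) + 4 * (t - s) / δ ^ 2 + 3 * (t - s) / (2 * (s - 𝔗)) + 1)) := by
  intro s t hs hst x hx y hy
  have hts : 0 < t - s := sub_pos.2 hst
  have hsT : 0 < s - 𝔗 := sub_pos.2 hs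
  have ha : 0 ≤ dist x y ^ 2 / (t - s) := by positivity
  have hb : 0 ≤ 4 * (t - s) / δ ^ 2 := by positivity
  have hc : 0 ≤ 3 * (t - s) / (2 * (s - 𝔗)) := by positivity
  set M := dist x y ^ 2 / (t - s) + 4 * (t - s) / δ ^ 2 + 3 * (t - s) / (2 * (s - 𝔗)) with hM
  obtain ⟨k, hMk, hkM⟩ : ∃ k : ℕ, M < k ∧ (k : ℝ) ≤ M + 1 :=
    ⟨⌊M⌋₊ + 1, by exact_mod_cast Nat.lt_floor_add_one M, by
      push_cast
      linarith [Nat.floor_le (show 0 ≤ M by positivity)]⟩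
  have hk0 : (0 : ℝ) < k := by linarith
  have ha' : dist x y ^ 2 < k * (t - s) := (div_lt_iff₀ hts).1 (by linarith)
  have hb' : 4 * (t - s) < k * δ ^ 2 := (div_lt_iff₀ (by positivity)).1 (by linarith)
  have hc' : 3 * (t - s) < k * (2 * (s - 𝔗)) := (div_lt_iff₀ (by positivity)).1 (by linarith)
  obtain ⟨R, hR, hkR⟩ : ∃ R : ℝ, 0 < R ∧ k * R ^ 2 = t - s := by
    refine ⟨√((t - s) / k), by positivity, ?_⟩
    rw [Real.sq_sqrt (by positivity)]
    field_simp
  have hRδ : 2 * R ≤ δ := by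
    refine (lt_of_pow_lt_pow_left₀ 2 hδ.le (lt_of_mul_lt_mul_left ?_ hk0.le)).le
    linarith
  have hR𝔗 : 3 / 2 * R ^ 2 < s - 𝔗 := by
    refine lt_of_mul_lt_mul_left ?_ hk0.le
    linarith
  have hxy : dist x y < k * R := by
    refine lt_of_pow_lt_pow_left₀ 2 (by positivity) ?_
    rw [← hkR] at ha'
    linarith
  have hstep : ∀ z ∈ O', ∀ τ, s ≤ τ → ∀ z' ∈ ball z R, u (τ, z) ≤ C₀ * u (τ + R ^ 2, z') :=
    fun z hz τ hτ ↦ hHarnack z (hO'O hz) R hR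
      (ball_subset_of_le_infDist_frontier hO (hO'O hz) (hRδ.trans (hdist z hz))) τ (by linarith)
  have hC₀pos : 0 < C₀ := by linarith
  have hchain := le_pow_mul_of_harnack_chain hconv hC₀pos.le hstep hx hy
    (by exact_mod_cast hk0) hxy
  rw [hkR, add_sub_cancel, mul_comm] at hchain
  refine hchain.trans (mul_le_mul_of_nonneg_left ?_ (hu _))
  rw [← Real.rpow_natCast, Real.rpow_def_of_pos hC₀pos]
  exact Real.exp_le_exp.2 (mul_le_mul_of_nonneg_left hkM (Real.log_nonneg hC₀))
end

section
/- Let 𝔗 ∈ ℝ and let u : (𝔗,∞)×ℝⁿ → [0,∞) satisfy the following Harnack-type property for some constant C₀ ≥ 1: for every z ∈ ℝⁿ, every R > 0, every τ with 𝔗 < τ − (3/2)R², and every z' ∈ B(z,R), one has u(τ,z) ≤ C₀·u(τ+R², z'). Then for all t > s > 𝔗 and all x, y ∈ ℝⁿ: u(s,y) ≤ u(t,x) · exp( (log C₀)·( |x−y|²/(t−s) + 3(t−s)/(2(s−𝔗)) + 1 ) ). -/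
open MeasureTheory Metric Set ENNReal

/-- Iterating a one-step Harnack inequality along equally spaced space-time points
`(s + k R², y + k v)`. -/
theorem harnack_chain {E : Type*} [SeminormedAddCommGroup E] {T : ℝ} {u : ℝ × E → ℝ}
    {C : ℝ} (hC : 0 ≤ C)
    (hHarnack : ∀ (z : E) (R : ℝ), 0 < R → ∀ τ : ℝ, T < τ - 3 / 2 * R ^ 2 →
      ∀ z' ∈ ball z R, u (τ, z) ≤ C * u (τ + R ^ 2, z'))
    {s R : ℝ} (hR : 0 < R) (hs : T < s - 3 / 2 * R ^ 2) (y v : E) (hv : ‖v‖ < R) (k : ℕ) :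
    u (s, y) ≤ C ^ k * u (s + k * R ^ 2, y + k • v) := by
  induction k with
  | zero => simp
  | succ k ih =>
    have hτ : T < s + k * R ^ 2 - 3 / 2 * R ^ 2 := by
      have : 0 ≤ (k : ℝ) * R ^ 2 := by positivity
      linarith
    have hmem : y + (k + 1) • v ∈ ball (y + k • v) R := by
      rw [mem_ball_iff_norm, succ_nsmul]
      convert hv using 2
      abel
    calc u (s, y) ≤ C ^ k * u (s + k * R ^ 2, y + k • v) := ih
      _ ≤ C ^ k * (C * u (s + k * R ^ 2 + R ^ 2, y + (k + 1) • v)) :=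
        mul_le_mul_of_nonneg_left (hHarnack _ R hR _ hτ _ hmem) (pow_nonneg hC k)
      _ = C ^ (k + 1) * u (s + (k + 1 : ℕ) * R ^ 2, y + (k + 1) • v) := by
        rw [pow_succ C, mul_assoc, Nat.cast_succ, add_mul, one_mul, add_assoc]

/-- Harnack chain iteration on the whole space. Let `𝔗 ∈ ℝ` and let
`u : (𝔗,∞)×ℝⁿ → [0,∞)` satisfy, for some `C₀ ≥ 1`: for every `z ∈ ℝⁿ`, `R > 0`, every `τ`
with `𝔗 < τ − (3/2)R²` and every `z' ∈ B(z,R)`, `u(τ,z) ≤ C₀ u(τ+R²,z')`. Then for all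
`t > s > 𝔗` and all `x, y ∈ ℝⁿ`:
`u(s,y) ≤ u(t,x) exp((log C₀)(|x−y|²/(t−s) + 3(t−s)/(2(s−𝔗)) + 1))`. -/
theorem statement6 (n : ℕ) (𝔗 : ℝ)
    (u : ℝ × EuclideanSpace ℝ (Fin n) → ℝ) (hu : ∀ p, 0 ≤ u p)
    (C₀ : ℝ) (hC₀ : 1 ≤ C₀)
    (hHarnack : ∀ (z : EuclideanSpace ℝ (Fin n)) (R : ℝ), 0 < R →
      ∀ τ : ℝ, 𝔗 < τ - 3 / 2 * R ^ 2 →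
      ∀ z' ∈ ball z R, u (τ, z) ≤ C₀ * u (τ + R ^ 2, z')) :
    ∀ s t : ℝ, 𝔗 < s → s < t → ∀ x y : EuclideanSpace ℝ (Fin n),
      u (s, y) ≤ u (t, x) *
        Real.exp (Real.log C₀ *
          (dist x y ^ 2 / (t - s) + 3 * (t - s) / (2 * (s - 𝔗)) + 1)) := by
  intro s t hs hst x y
  have ht : 0 < t - s := sub_pos.2 hst
  have hs' : 0 < s - 𝔗 := sub_pos.2 hs
  set a : ℝ := dist x y ^ 2 / (t - s) with ha
  set b : ℝ := 3 * (t - s) / (2 * (s - 𝔗)) with hb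
  have ha0 : 0 ≤ a := by positivity
  have hb0 : 0 ≤ b := by positivity
  set N : ℕ := ⌊a + b⌋₊ + 1 with hN
  have hlt : a + b < N := by
    rw [hN, Nat.cast_succ]
    exact Nat.lt_floor_add_one _
  have hle : (N : ℝ) ≤ a + b + 1 := by
    rw [hN, Nat.cast_succ]
    linarith [Nat.floor_le (add_nonneg ha0 hb0)]
  have hN0 : (0 : ℝ) < N := by linarith
  have hR2 : √((t - s) / N) ^ 2 = (t - s) / N := Real.sq_sqrt (by positivity)
  have htime : 𝔗 < s - 3 / 2 * √((t - s) / N) ^ 2 := by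
    have h : b < N := by linarith
    rw [hb, div_lt_iff₀ (by positivity)] at h
    have : (t - s) / N < 2 / 3 * (s - 𝔗) := by
      rw [div_lt_iff₀ hN0]
      linarith
    rw [hR2]
    linarith
  have hspace : ‖(N : ℝ)⁻¹ • (x - y)‖ < √((t - s) / N) := by
    have h : a < N := by linarith
    rw [ha, div_lt_iff₀ ht] at h
    rw [norm_smul, Real.norm_of_nonneg (by positivity), ← dist_eq_norm]
    apply Real.lt_sqrt_of_sq_lt
    rw [lt_div_iff₀ hN0]
    calc ((N : ℝ)⁻¹ * dist x y) ^ 2 * N = dist x y ^ 2 / N := by field_simp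
      _ < t - s := by
        rw [div_lt_iff₀ hN0]
        linarith
  have hchain := harnack_chain (zero_le_one.trans hC₀) hHarnack (Real.sqrt_pos.2 (by positivity))
    htime y _ hspace N
  have htend : s + N * √((t - s) / N) ^ 2 = t := by
    rw [hR2, mul_div_cancel₀ _ hN0.ne']
    ring
  have hxend : y + N • ((N : ℝ)⁻¹ • (x - y)) = x := by
    rw [← Nat.cast_smul_eq_nsmul ℝ, smul_inv_smul₀ hN0.ne', add_sub_cancel]
  rw [htend, hxend, mul_comm] at hchain
  refine hchain.trans (mul_le_mul_of_nonneg_left ?_ (hu _))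
  rw [← Real.rpow_natCast, Real.rpow_def_of_pos (zero_lt_one.trans_le hC₀)]
  exact Real.exp_le_exp.2 (mul_le_mul_of_nonneg_left hle (Real.log_nonneg hC₀))
end

section
/- Let 𝔗 ∈ ℝ, let μ be a Borel measure on ℝⁿ which is nonzero and finite on all balls, and let u : (𝔗,∞)×ℝⁿ → [0,∞) be such that u(σ,·) is continuous on ℝⁿ for every σ > 𝔗 and such that for some C₀ ≥ 1: u(s,y) ≤ u(t,x)·exp( C₀·( |x−y|²/(t−s) + 3(t−s)/(2(s−𝔗)) + 1 ) ) for all t > s > 𝔗 and all x, y ∈ ℝⁿ. Fix y ∈ ℝⁿ, γ > 0 and a family of positive reals (α_{s,t})_{t>s>𝔗}, and assume 𝓜 := inf_{t>s>𝔗} α_{s,t}^{−1} · ∫_{B(y,√(γ(t−s)))} u(t,x) dμ(x) > 0. Then there exist constants c = c(C₀) > 0 and C = C(γ, C₀) > 0 such that for all t > s > 𝔗 and all x ∈ ℝⁿ: C·𝓜 · exp(−c·( |x−y|²/(t−s) + (t−s)/(s−𝔗) )) / μ(B(y,√(γ(t−s)))) · α_{s, s+(t−s)/2} ≤ u(t,x).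 -/
open MeasureTheory Metric Set ENNReal

/-- Splitting the Harnack exponent through a point `z` close to `y`. -/
theorem harnack_exponent_le {E : Type*} [PseudoMetricSpace E] {x y z : E} {γ a d : ℝ}
    (ha : 0 < a) (hd : 0 < d) (hz : dist z y ^ 2 ≤ γ * (d / 2)) :
    dist x z ^ 2 / (d / 2) + 3 * (d / 2) / (2 * (a + d / 2)) + 1 ≤
      4 * (dist x y ^ 2 / d + d / a) + (2 * γ + 1) := by
  have hsq : dist x z ^ 2 ≤ 2 * dist x y ^ 2 + γ * d := by
    have htri : dist x z ≤ dist x y + dist z y := dist_triangle_right x z y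
    nlinarith [sq_nonneg (dist x y - dist z y), dist_nonneg (x := x) (y := z),
      dist_nonneg (x := x) (y := y), dist_nonneg (x := z) (y := y)]
  have hspace : dist x z ^ 2 / (d / 2) ≤ 4 * (dist x y ^ 2 / d) + 2 * γ := by
    calc dist x z ^ 2 / (d / 2) ≤ (2 * dist x y ^ 2 + γ * d) / (d / 2) := by gcongr
      _ = 4 * (dist x y ^ 2 / d) + 2 * γ := by field_simp; ring
  have htime : 3 * (d / 2) / (2 * (a + d / 2)) ≤ 4 * (d / a) := by
    calc 3 * (d / 2) / (2 * (a + d / 2)) ≤ 3 * (d / 2) / (2 * a) := by gcongr; linarith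
      _ = 3 / 4 * (d / a) := by field_simp; ring
      _ ≤ 4 * (d / a) := by gcongr; norm_num
  linarith

/-- Lower bound from a Harnack chain estimate and a lower bound on ball
averages. `u : (𝔗,∞)×ℝⁿ → [0,∞)` is continuous in space for each fixed time, and satisfies
the Harnack-chain estimate with constant `C₀ ≥ 1`. There are `c = c(C₀) > 0` and
`C = C(γ,C₀) > 0` such that: if `μ` is a Borel measure nonzero and finite on balls, `y ∈ ℝⁿ`,
`(α_{s,t})` a family of positive reals and `𝓜 > 0` is a lower bound for
`α_{s,t}⁻¹ ∫_{B(y,√(γ(t−s)))} u(t,·) dμ` over all `t > s > 𝔗`, then for all `t > s > 𝔗` and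
all `x`, `C 𝓜 e^{−c(|x−y|²/(t−s) + (t−s)/(s−𝔗))} / μ(B(y,√(γ(t−s)))) · α_{s,s+(t−s)/2} ≤ u(t,x)`. -/
theorem statement7 (n : ℕ) (C₀ : ℝ) (hC₀ : 1 ≤ C₀) :
    ∃ c : ℝ, 0 < c ∧ ∀ γ : ℝ, 0 < γ → ∃ C : ℝ, 0 < C ∧
      ∀ (𝔗 : ℝ) (μ : Measure (EuclideanSpace ℝ (Fin n))),
        (∀ (x : EuclideanSpace ℝ (Fin n)) (r : ℝ), 0 < r → μ (ball x r) ≠ 0 ∧ μ (ball x r) ≠ ⊤) →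
        ∀ u : ℝ × EuclideanSpace ℝ (Fin n) → ℝ,
          (∀ p, 0 ≤ u p) →
          (∀ σ : ℝ, 𝔗 < σ → Continuous fun x => u (σ, x)) →
          (∀ s t : ℝ, 𝔗 < s → s < t → ∀ x y : EuclideanSpace ℝ (Fin n),
            u (s, y) ≤ u (t, x) *
              Real.exp (C₀ * (dist x y ^ 2 / (t - s) + 3 * (t - s) / (2 * (s - 𝔗)) + 1))) →
          ∀ (y : EuclideanSpace ℝ (Fin n)) (α : ℝ → ℝ → ℝ),
            (∀ s t : ℝ, 𝔗 < s → s < t → 0 < α s t) →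
            ∀ 𝓜 : ℝ, 0 < 𝓜 →
              (∀ s t : ℝ, 𝔗 < s → s < t →
                ENNReal.ofReal (𝓜 * α s t) ≤
                  ∫⁻ x in ball y (Real.sqrt (γ * (t - s))), ENNReal.ofReal (u (t, x)) ∂μ) →
              ∀ s t : ℝ, 𝔗 < s → s < t → ∀ x : EuclideanSpace ℝ (Fin n),
                C * 𝓜 * Real.exp (-(c * (dist x y ^ 2 / (t - s) + (t - s) / (s - 𝔗)))) /
                    (μ (ball y (Real.sqrt (γ * (t - s))))).toReal * α s (s + (t - s) / 2)
                  ≤ u (t, x) := by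
  refine ⟨4 * C₀, by positivity, fun γ hγ => ⟨Real.exp (-(C₀ * (2 * γ + 1))),
    Real.exp_pos _, ?_⟩⟩
  intro 𝔗 μ hμ u hu _ hH y α _ 𝓜 _ hint s t hs hst x
  have hd : 0 < t - s := sub_pos.2 hst
  have ha : 0 < s - 𝔗 := sub_pos.2 hs
  set m := s + (t - s) / 2 with hm
  have hsm : s < m := by linarith
  have hmt : m < t := by linarith
  set Q := dist x y ^ 2 / (t - s) + (t - s) / (s - 𝔗) with hQ
  set K := Real.exp (C₀ * (4 * Q + (2 * γ + 1))) with hK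
  set B := ball y (Real.sqrt (γ * (t - s))) with hB
  have hr : 0 < Real.sqrt (γ * (t - s)) := Real.sqrt_pos.2 (by positivity)
  obtain ⟨hB0, hBtop⟩ := hμ y _ hr
  have hBpos : 0 < (μ B).toReal := ENNReal.toReal_pos hB0 hBtop
  have hK0 : 0 ≤ u (t, x) * K := mul_nonneg (hu _) (Real.exp_pos _).le
  have hpt : ∀ z ∈ ball y (Real.sqrt (γ * (m - s))), u (m, z) ≤ u (t, x) * K := by
    intro z hz
    refine (hH m t (hs.trans hsm) hmt x z).trans ?_
    refine mul_le_mul_of_nonneg_left (Real.exp_le_exp.2 ?_) (hu _)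
    have hz' : dist z y ^ 2 ≤ γ * ((t - s) / 2) := by
      have hms : m - s = (t - s) / 2 := by rw [hm]; ring
      rw [hms] at hz
      exact (Real.le_sqrt dist_nonneg (by positivity)).1 (mem_ball.1 hz).le
    have h := harnack_exponent_le (x := x) ha hd hz'
    have e₁ : t - m = (t - s) / 2 := by rw [hm]; ring
    have e₂ : m - 𝔗 = s - 𝔗 + (t - s) / 2 := by rw [hm]; ring
    rw [e₁, e₂]
    exact mul_le_mul_of_nonneg_left h (by positivity)
  have hsub : ball y (Real.sqrt (γ * (m - s))) ⊆ B :=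
    ball_subset_ball (Real.sqrt_le_sqrt (by gcongr))
  have hlint : ENNReal.ofReal (𝓜 * α s m) ≤ ENNReal.ofReal (u (t, x) * K * (μ B).toReal) :=
    calc ENNReal.ofReal (𝓜 * α s m)
        ≤ ∫⁻ z in ball y (Real.sqrt (γ * (m - s))), ENNReal.ofReal (u (m, z)) ∂μ :=
          hint s m hs hsm
      _ ≤ ∫⁻ _ in ball y (Real.sqrt (γ * (m - s))), ENNReal.ofReal (u (t, x) * K) ∂μ :=
          setLIntegral_mono' measurableSet_ball fun z hz => ENNReal.ofReal_le_ofReal (hpt z hz)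
      _ = ENNReal.ofReal (u (t, x) * K) * μ (ball y (Real.sqrt (γ * (m - s)))) :=
          setLIntegral_const _ _
      _ ≤ ENNReal.ofReal (u (t, x) * K) * μ B := by gcongr
      _ = ENNReal.ofReal (u (t, x) * K * (μ B).toReal) := by
          rw [ENNReal.ofReal_mul hK0, ENNReal.ofReal_toReal hBtop]
  have hreal : 𝓜 * α s m ≤ u (t, x) * K * (μ B).toReal :=
    (ENNReal.ofReal_le_ofReal_iff (by positivity)).1 hlint
  have hexp : Real.exp (-(C₀ * (2 * γ + 1))) * Real.exp (-(4 * C₀ * Q)) = K⁻¹ := by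
    rw [hK, ← Real.exp_neg, ← Real.exp_add]
    congr 1
    ring
  calc Real.exp (-(C₀ * (2 * γ + 1))) * 𝓜 * Real.exp (-(4 * C₀ * Q)) / (μ B).toReal * α s m
      = K⁻¹ * (𝓜 * α s m) / (μ B).toReal := by rw [← hexp]; ring
    _ ≤ K⁻¹ * (u (t, x) * K * (μ B).toReal) / (μ B).toReal := by gcongr
    _ = u (t, x) := by
        have : K ≠ 0 := (Real.exp_pos _).ne'
        field_simp
end
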